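/- For all real y, all naturals N ≥ 1 and n ≥ 2, the Quasi-Hermite polynomials satisfy the recurrence H_{n+1}(x,y;N) - X·Hₙ(x,y;N) - 2ny • H_{n-1}(x,y;N) = (y/N) n(n-1) • (X·H_{n-2}(x,y;N) - H_{n-1}(x,y;N)). -/

import Mathlib

open Polynomial

/-- Formal differentiation on `ℝ[X]`, as a linear endomorphism. -/
noncomputable def D : Module.End ℝ (Polynomial ℝ) := Polynomial.derivative

/-- The Quasi-Hermite polynomial `Hₙ(x,y;N) := ((1 + (y/N) • D²)^N)(Xⁿ)`. -/
noncomputable def QH (y : ℝ) (N n : ℕ) : Polynomial ℝ :=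
  (((1 : Module.End ℝ (Polynomial ℝ)) + (y / (N : ℝ)) • D ^ 2) ^ N) ((Polynomial.X : Polynomial ℝ) ^ n)

theorem one_add_smul_D_sq_apply (a : ℝ) (p : ℝ[X]) :
    ((1 : Module.End ℝ ℝ[X]) + a • D ^ 2) p = p + a • derivative (derivative p) := by
  simp [D, pow_two]

/-- The commutator of `(1 + a D²)^(M+1)` with multiplication by `X`. -/
theorem one_add_smul_D_sq_pow_X_mul (a : ℝ) (M : ℕ) (p : ℝ[X]) :
    (((1 : Module.End ℝ ℝ[X]) + a • D ^ 2) ^ (M + 1)) (X * p) =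
      X * (((1 : Module.End ℝ ℝ[X]) + a • D ^ 2) ^ (M + 1)) p +
        (2 * a * ((M : ℝ) + 1)) •
          (((1 : Module.End ℝ ℝ[X]) + a • D ^ 2) ^ M) (derivative p) := by
  set T : Module.End ℝ ℝ[X] := 1 + a • D ^ 2 with hT
  have apply_X_mul (q : ℝ[X]) : T (X * q) = X * T q + (2 * a) • derivative q := by
    simp only [hT, one_add_smul_D_sq_apply, derivative_mul, derivative_X, derivative_add,
      derivative_one, smul_eq_C_mul, map_mul, map_ofNat]
    ring
  have derivative_apply (q : ℝ[X]) : derivative (T q) = T (derivative q) := by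
    simp [hT, D, pow_two]
  induction M generalizing p with
  | zero => simp [apply_X_mul]
  | succ M ih =>
    rw [pow_succ T (M + 1), Module.End.mul_apply, apply_X_mul, map_add, map_smul, ih,
      derivative_apply, ← Module.End.mul_apply (T ^ M) T, ← pow_succ, Module.End.mul_apply]
    push_cast
    module

/-- Three-term-type recurrence of the Quasi-Hermite polynomials:
`H_{n+1} - X·Hₙ - 2ny • H_{n-1} = (y/N) n(n-1) • (X·H_{n-2} - H_{n-1})` for `n ≥ 2`. -/
theorem quasi_hermite_recurrence (y : ℝ) (N n : ℕ) (hN : 1 ≤ N) (hn : 2 ≤ n) :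
    QH y N (n + 1) - Polynomial.X * QH y N n - (2 * (n : ℝ) * y) • QH y N (n - 1) =
      ((y / (N : ℝ)) * (n : ℝ) * ((n : ℝ) - 1)) •
        (Polynomial.X * QH y N (n - 2) - QH y N (n - 1)) := by
  obtain ⟨M, rfl⟩ := Nat.exists_eq_add_of_le' hN
  obtain ⟨m, rfl⟩ := Nat.exists_eq_add_of_le' hn
  have hM : ((M + 1 : ℕ) : ℝ) ≠ 0 := by positivity
  obtain ⟨a, rfl⟩ : ∃ a : ℝ, y = a * ((M + 1 : ℕ) : ℝ) := ⟨_, (div_mul_cancel₀ y hM).symm⟩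
  simp only [QH, mul_div_cancel_right₀ a hM, show m + 2 - 1 = m + 1 from rfl,
    Nat.add_sub_cancel]
  have h₁ := one_add_smul_D_sq_pow_X_mul a M (X ^ (m + 2))
  have h₂ := one_add_smul_D_sq_pow_X_mul a M (X ^ m)
  set T : Module.End ℝ ℝ[X] := 1 + a • D ^ 2 with hT
  have h₃ : T (X ^ (m + 1)) = X ^ (m + 1) + (a * ((m : ℝ) + 1)) • derivative (X ^ m) := by
    rw [hT, one_add_smul_D_sq_apply, derivative_X_pow_succ, derivative_C_mul, mul_smul,
      smul_eq_C_mul ((m : ℝ) + 1)]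
  have h₄ : (T ^ (M + 1)) (X ^ (m + 1)) =
      (T ^ M) (X ^ (m + 1)) + (a * ((m : ℝ) + 1)) • (T ^ M) (derivative (X ^ m)) := by
    rw [pow_succ, Module.End.mul_apply, h₃, map_add, map_smul]
  rw [derivative_X_pow_succ, ← smul_eq_C_mul, map_smul, ← pow_succ'] at h₁
  rw [← pow_succ'] at h₂
  have h₅ : X * (T ^ (M + 1)) (X ^ m) - (T ^ (M + 1)) (X ^ (m + 1)) =
      -((2 * a * ((M : ℝ) + 1)) • (T ^ M) (derivative (X ^ m))) := by
    rw [h₂]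
    abel
  rw [h₅, h₁, h₄]
  push_cast
  module
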